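/- Let m ≥ 4 and let p = (p₁,…,p_m) and q = (q₁,…,q_m) be semi-normalized m-tuples of null vectors in ℍ^{n+1} (the case i = m: all entries null, pairwise projectively distinct). Suppose 𝔸(p₁,p₂,p₃) = 𝔸(q₁,q₂,q₃) and there exists a unit quaternion μ such that u(g^p_{23}) = conj(μ)·u(g^q_{23})·μ and each of the m(m−3)/2 cross ratios 𝕏(p₁,p₂,p₃,p_j) and 𝕏(p₁,p₃,p₂,p_j) for 4 ≤ j ≤ m, and 𝕏(p₁,p_k,p₂,p_j) for 4 ≤ k < j ≤ m, equals conj(μ) times the corresponding cross ratio of q times μ. Then p and q are PSp(n,1)-congruent. -/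

import Mathlib

noncomputable section

open Quaternion Matrix
open scoped Classical

abbrev ℍq : Type := Quaternion ℝ

/-- Hermitian form matrix of signature (n,1). -/
def qHmat (n : ℕ) : Matrix (Fin (n+1)) (Fin (n+1)) ℍq := fun k j =>
  if (k = 0 ∧ j = Fin.last n) ∨ (k = Fin.last n ∧ j = 0) then 1
  else if k = j ∧ k ≠ 0 ∧ k ≠ Fin.last n then 1 else 0

/-- `herm n z w = ⟨z,w⟩ = w* H z`. -/
def herm (n : ℕ) (z w : Fin (n+1) → ℍq) : ℍq :=
  ∑ k, ∑ j, star (w k) * qHmat n k j * z j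

/-- Two `m`-tuples of vectors are PSp(n,1)-congruent if some `C ∈ Sp(n,1)` carries each
`p k` to `q k` up to a nonzero right quaternionic scalar. -/
def PSpCongruent (n m : ℕ) (p q : Fin m → Fin (n+1) → ℍq) : Prop :=
  ∃ C : Matrix (Fin (n+1)) (Fin (n+1)) ℍq, Cᴴ * qHmat n * C = qHmat n ∧
    ∃ μ : Fin m → ℍq, (∀ k, μ k ≠ 0) ∧ ∀ k, C.mulVec (p k) = fun j => q k j * μ k

/-- An `m`-tuple `p` (first `i` entries null, the rest negative, pairwise projectively
distinct) is semi-normalized if its Gram matrix `g_{kj} = ⟨p_j, p_k⟩` satisfies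
`g_{kk} = 0` for `1 ≤ k ≤ i`, `|g_{23}| = 1`, `g_{1j} = 1` for `2 ≤ j ≤ i`,
`g_{kk} = −1` for `i+1 ≤ k ≤ m`, and `g_{1j}` positive real for `i+1 ≤ j ≤ m`
(1-based indexing). -/
def SemiNormalized (n m i : ℕ) (p : Fin m → Fin (n+1) → ℍq) : Prop :=
  (∀ k, p k ≠ 0) ∧
  (∀ k l : Fin m, k ≠ l → ∀ c : ℍq, p k ≠ fun j => p l j * c) ∧
  (∀ k : Fin m, (k : ℕ) < i → herm n (p k) (p k) = 0) ∧
  (∀ k j : Fin m, (k : ℕ) = 1 → (j : ℕ) = 2 → ‖herm n (p j) (p k)‖ = 1) ∧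
  (∀ k j : Fin m, (k : ℕ) = 0 → 1 ≤ (j : ℕ) → (j : ℕ) < i → herm n (p j) (p k) = 1) ∧
  (∀ k : Fin m, i ≤ (k : ℕ) → herm n (p k) (p k) = -1) ∧
  (∀ k j : Fin m, (k : ℕ) = 0 → i ≤ (j : ℕ) → ∃ r : ℝ, 0 < r ∧ herm n (p j) (p k) = (r : ℍq))

/-- The Korányi–Reimann quaternionic cross ratio. -/
def crossRatio (n : ℕ) (z1 z2 z3 z4 : Fin (n+1) → ℍq) : ℍq :=
  herm n z3 z1 * (herm n z3 z2)⁻¹ * herm n z4 z2 * (herm n z4 z1)⁻¹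

/-- The quaternionic Cartan angular invariant
`𝔸(z₁,z₂,z₃) = arccos(Re(−T)/|T|)` with `T = ⟨z₁,z₂⟩⟨z₂,z₃⟩⟨z₃,z₁⟩`. -/
def angInv (n : ℕ) (z1 z2 z3 : Fin (n+1) → ℍq) : ℝ :=
  Real.arccos ((-(herm n z1 z2 * herm n z2 z3 * herm n z3 z1)).re /
    ‖herm n z1 z2 * herm n z2 z3 * herm n z3 z1‖)

/-- The rotation invariant `u(g) = Im g / |Im g|` (and `0` if `Im g = 0`). -/
def rotInv (g : ℍq) : ℍq := if g.im = 0 then 0 else (‖g.im‖)⁻¹ • g.im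

/-- The distance invariant `d(z,w) = (⟨w,z⟩·⟨z,w⟩)/(⟨w,w⟩·⟨z,z⟩)`. -/
def dInv (n : ℕ) (z w : Fin (n+1) → ℍq) : ℍq :=
  (herm n w z * herm n z w) / (herm n w w * herm n z z)

section HermitianForm

variable {n : ℕ}

lemma herm_eq_dotProduct (z w : Fin (n+1) → ℍq) :
    herm n z w = star w ⬝ᵥ (qHmat n *ᵥ z) := by
  simp only [herm, dotProduct, mulVec, Finset.mul_sum, mul_assoc, Pi.star_apply]

lemma qHmat_conjTranspose : (qHmat n)ᴴ = qHmat n := by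
  ext1 i j
  simp only [conjTranspose_apply, qHmat]
  split_ifs <;> first | (simp; done) | (exfalso; grind)

lemma star_herm (z w : Fin (n+1) → ℍq) : star (herm n z w) = herm n w z := by
  rw [herm_eq_dotProduct, herm_eq_dotProduct, star_dotProduct, star_star, star_mulVec,
    qHmat_conjTranspose, dotProduct_mulVec]

lemma herm_sub_left (z z' w : Fin (n+1) → ℍq) :
    herm n (z - z') w = herm n z w - herm n z' w := by
  simp only [herm_eq_dotProduct, mulVec_sub, dotProduct_sub]

lemma herm_neg_left (z w : Fin (n+1) → ℍq) : herm n (-z) w = -herm n z w := by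
  simp only [herm_eq_dotProduct, mulVec_neg, dotProduct_neg]

lemma herm_mul_left (z w : Fin (n+1) → ℍq) (a : ℍq) :
    herm n (fun j => z j * a) w = herm n z w * a := by
  simp only [herm, Finset.sum_mul, mul_assoc]

lemma herm_sub_right (z w w' : Fin (n+1) → ℍq) :
    herm n z (w - w') = herm n z w - herm n z w' := by
  simp only [herm_eq_dotProduct, star_sub, sub_dotProduct]

lemma herm_neg_right (z w : Fin (n+1) → ℍq) : herm n z (-w) = -herm n z w := by
  simp only [herm_eq_dotProduct, star_neg, neg_dotProduct]

lemma herm_mul_right (z w : Fin (n+1) → ℍq) (a : ℍq) :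
    herm n z (fun j => w j * a) = star a * herm n z w := by
  simp only [herm, Finset.mul_sum, mul_assoc, star_mul]

lemma qHmat_mulVec (z : Fin (n+1) → ℍq) (h : z 0 = z (Fin.last n)) :
    qHmat n *ᵥ z = z := by
  funext k
  simp only [mulVec, dotProduct]
  by_cases h0 : k = 0
  · rw [Finset.sum_eq_single (Fin.last n)]
    · simp [qHmat, h0, h]
    · intro j _ hj
      simp only [qHmat]
      split_ifs <;> first | (simp; done) | (exfalso; grind)
    · simp
  by_cases hl : k = Fin.last n
  · rw [Finset.sum_eq_single 0]
    · simp [qHmat, hl, h]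
    · intro j _ hj
      simp only [qHmat]
      split_ifs <;> first | (simp; done) | (exfalso; grind)
    · simp
  · rw [Finset.sum_eq_single k]
    · simp [qHmat, h0, hl]
    · intro j _ hj
      simp only [qHmat]
      split_ifs <;> first | (simp; done) | (exfalso; grind)
    · simp

lemma herm_self_of_balanced (z : Fin (n+1) → ℍq) (h : z 0 = z (Fin.last n)) :
    herm n z z = ((∑ k, normSq (z k) : ℝ) : ℍq) := by
  rw [herm_eq_dotProduct, qHmat_mulVec z h]
  simp only [dotProduct, Pi.star_apply, Quaternion.star_mul_self]
  exact (map_sum (algebraMap ℝ ℍq) _ _).symm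

lemma re_herm_self_nonneg_of_balanced (z : Fin (n+1) → ℍq) (h : z 0 = z (Fin.last n)) :
    0 ≤ (herm n z z).re := by
  rw [herm_self_of_balanced z h, Quaternion.re_coe]
  exact Finset.sum_nonneg fun _ _ => normSq_nonneg

lemma eq_zero_of_balanced (z : Fin (n+1) → ℍq) (h : z 0 = z (Fin.last n))
    (h0 : (herm n z z).re ≤ 0) : z = 0 := by
  rw [herm_self_of_balanced z h, Quaternion.re_coe] at h0
  have := (Finset.sum_eq_zero_iff_of_nonneg fun k _ => normSq_nonneg (a := z k)).1
    (le_antisymm h0 (Finset.sum_nonneg fun _ _ => normSq_nonneg))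
  funext k
  exact normSq_eq_zero.1 (this k (Finset.mem_univ k))

/-- A nonzero vector of nonpositive norm can be used to make any other vector balanced. -/
lemma exists_balanced (x w : Fin (n+1) → ℍq) (hx : x ≠ 0) (hxx : (herm n x x).re ≤ 0) :
    ∃ c : ℍq, (w - fun j => x j * c) 0 = (w - fun j => x j * c) (Fin.last n) := by
  have ht : x 0 - x (Fin.last n) ≠ 0 := fun h =>
    hx (eq_zero_of_balanced x (sub_eq_zero.1 h) hxx)
  refine ⟨(x 0 - x (Fin.last n))⁻¹ * (w 0 - w (Fin.last n)), ?_⟩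
  rw [← sub_eq_zero]
  simp only [Pi.sub_apply]
  have : (x 0 - x (Fin.last n)) * ((x 0 - x (Fin.last n))⁻¹ * (w 0 - w (Fin.last n)))
      = w 0 - w (Fin.last n) := mul_inv_cancel_left₀ ht _
  rw [sub_mul, ← sub_eq_zero] at this
  rw [← neg_eq_zero, ← this]
  abel

/-- The form is positive definite on the orthogonal complement of a negative vector. -/
lemma re_herm_self_pos (x w : Fin (n+1) → ℍq) (hxx : (herm n x x).re < 0)
    (hwx : herm n w x = 0) (hw : w ≠ 0) : 0 < (herm n w w).re := by
  have hx : x ≠ 0 := by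
    rintro rfl
    simp [herm] at hxx
  obtain ⟨c, hc⟩ := exists_balanced x w hx hxx.le
  have hxw : herm n x w = 0 := by rw [← star_herm, hwx, star_zero]
  have hreal : herm n x x = ((herm n x x).re : ℍq) :=
    Quaternion.star_eq_self.1 (star_herm x x)
  have key : (herm n (w - fun j => x j * c) (w - fun j => x j * c)).re
      = (herm n w w).re + normSq c * (herm n x x).re := by
    rw [herm_sub_left, herm_sub_right, herm_sub_right, herm_mul_left, herm_mul_left,
      herm_mul_right, herm_mul_right, hxw, hwx, hreal]
    have : star c * ((herm n x x).re : ℍq) * c = ((normSq c * (herm n x x).re : ℝ) : ℍq) := by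
      rw [← Quaternion.coe_commutes, mul_assoc, Quaternion.star_mul_self, ← Quaternion.coe_mul,
        mul_comm]
    rw [this]
    simp
  have h1 := re_herm_self_nonneg_of_balanced _ hc
  by_contra hcon
  have hc0 : normSq c = 0 := by
    have := normSq_nonneg (a := c)
    nlinarith
  have hz := eq_zero_of_balanced _ hc (by rw [key, hc0]; linarith)
  rw [normSq_eq_zero] at hc0
  apply hw
  rw [← hz, hc0]
  funext j
  simp

/-- Projectively distinct null vectors are not orthogonal. -/
lemma herm_ne_zero_of_null (z w : Fin (n+1) → ℍq) (hz : z ≠ 0) (hzz : herm n z z = 0)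
    (hww : herm n w w = 0) (hdist : ∀ c : ℍq, w ≠ fun j => z j * c) : herm n z w ≠ 0 := by
  intro hzw
  have hwz : herm n w z = 0 := by rw [← star_herm, hzw, star_zero]
  obtain ⟨c, hc⟩ := exists_balanced z w hz (by simp [hzz])
  have h := eq_zero_of_balanced _ hc (by
    rw [herm_sub_left, herm_sub_right, herm_sub_right, herm_mul_left, herm_mul_left,
      herm_mul_right, herm_mul_right, hzw, hwz, hzz, hww]
    simp)
  exact hdist c (sub_eq_zero.1 h)

/-- The matrix `C` preserves the Hermitian form. -/
def IsHermIsometry (C : Matrix (Fin (n+1)) (Fin (n+1)) ℍq) : Prop :=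
  ∀ u v, herm n (C *ᵥ u) (C *ᵥ v) = herm n u v

lemma IsHermIsometry.mul {C D : Matrix (Fin (n+1)) (Fin (n+1)) ℍq}
    (hC : IsHermIsometry C) (hD : IsHermIsometry D) : IsHermIsometry (C * D) := by
  intro u v
  rw [← mulVec_mulVec, ← mulVec_mulVec, hC, hD]

lemma IsHermIsometry.neg {C : Matrix (Fin (n+1)) (Fin (n+1)) ℍq}
    (hC : IsHermIsometry C) : IsHermIsometry (-C) := by
  intro u v
  rw [neg_mulVec, neg_mulVec, herm_neg_left, herm_neg_right, neg_neg, hC]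

lemma IsHermIsometry.conjTranspose_mul_mul {C : Matrix (Fin (n+1)) (Fin (n+1)) ℍq}
    (hC : IsHermIsometry C) : Cᴴ * qHmat n * C = qHmat n := by
  have entry : ∀ M : Matrix (Fin (n+1)) (Fin (n+1)) ℍq, ∀ i j,
      star (Pi.single i 1 : Fin (n+1) → ℍq) ⬝ᵥ (M *ᵥ Pi.single j 1) = M i j := by
    intro M i j
    rw [← Pi.single_star, star_one, single_one_dotProduct, mulVec_single_one, col_apply]
  ext1 i j
  have h := hC (Pi.single j 1) (Pi.single i 1)
  rw [herm_eq_dotProduct, herm_eq_dotProduct, star_mulVec, ← dotProduct_mulVec, mulVec_mulVec,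
    mulVec_mulVec, entry, entry] at h
  exact h

/-- The quasi-reflection carrying `x` to `y` and fixing the vectors that cannot tell them apart. -/
lemma exists_quasireflection (x y : Fin (n+1) → ℍq) (hxy : herm n x x = herm n y y)
    (hb : herm n x (x - y) ≠ 0) :
    ∃ C : Matrix (Fin (n+1)) (Fin (n+1)) ℍq, IsHermIsometry C ∧ C *ᵥ x = y ∧
      ∀ v, herm n v x = herm n v y → C *ᵥ v = v := by
  obtain ⟨w, hw⟩ : ∃ w, w = x - y := ⟨_, rfl⟩
  rw [← hw] at hb
  obtain ⟨c, hc⟩ : ∃ c, c = (herm n x w)⁻¹ := ⟨_, rfl⟩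
  have hC : ∀ v, (1 - vecMulVec (fun i => w i * c) (star w ᵥ* qHmat n)) *ᵥ v
      = v - fun i => w i * (c * herm n v w) := by
    intro v
    rw [sub_mulVec, one_mulVec, herm_eq_dotProduct, dotProduct_mulVec]
    congr 1
    funext i
    simp only [mulVec, vecMulVec_apply, dotProduct, Finset.mul_sum, mul_assoc]
  have hww : herm n w w = herm n x w + star (herm n x w) := by
    rw [star_herm, hw]
    simp only [herm_sub_left, herm_sub_right, hxy]
    abel
  have hcc : star c * herm n w w * c = star c + c := by
    rw [hww, mul_add, add_mul, hc, mul_assoc, mul_inv_cancel₀ hb, ← star_mul,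
      mul_inv_cancel₀ hb, mul_one, star_one, one_mul]
  refine ⟨1 - vecMulVec (fun i => w i * c) (star w ᵥ* qHmat n), ?_, ?_, ?_⟩
  · intro u v
    rw [hC, hC, herm_sub_left, herm_sub_right, herm_sub_right, herm_mul_left, herm_mul_left,
      herm_mul_right, herm_mul_right, star_mul, star_herm]
    have : herm n w v * star c * herm n w w * (c * herm n u w)
        = herm n w v * (star c * herm n w w * c) * herm n u w := by noncomm_ring
    rw [this, hcc]
    noncomm_ring
  · rw [hC, hc, inv_mul_cancel₀ hb, hw]
    funext i
    simp
  · intro v hv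
    have : herm n v w = 0 := by rw [hw, herm_sub_right, hv, sub_self]
    rw [hC, this]
    funext i
    simp

/-- **Witt's theorem** for systems containing a negative vector. -/
theorem exists_isometry_of_gram_eq {ι : Type*} (s : Finset ι) (x y : Fin (n+1) → ℍq)
    (P Q : ι → Fin (n+1) → ℍq) (hx : (herm n x x).re < 0) (hxy : herm n x x = herm n y y)
    (hPx : ∀ k, herm n (P k) x = herm n (Q k) y)
    (hPQ : ∀ k l, herm n (P k) (P l) = herm n (Q k) (Q l)) :
    ∃ C : Matrix (Fin (n+1)) (Fin (n+1)) ℍq, IsHermIsometry C ∧ C *ᵥ x = y ∧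
      ∀ k ∈ s, C *ᵥ P k = Q k := by
  induction s using Finset.induction_on with
  | empty =>
    by_cases hb : herm n x (x - y) = 0
    · have hb' : herm n x (x - -y) ≠ 0 := by
        intro h
        have h2 : herm n x x + herm n x x = 0 := by
          have := congrArg₂ (· + ·) hb h
          simp only [herm_sub_right, herm_neg_right, add_zero] at this
          rw [← this]
          abel
        have := congrArg (fun a : ℍq => a.re) h2
        simp only [Quaternion.re_add, Quaternion.re_zero] at this
        linarith
      obtain ⟨C, hC, hCx, -⟩ := exists_quasireflection x (-y)
        (by rw [herm_neg_left, herm_neg_right, neg_neg, hxy]) hb'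
      exact ⟨-C, hC.neg, by rw [neg_mulVec, hCx, neg_neg], by simp⟩
    · obtain ⟨C, hC, hCx, -⟩ := exists_quasireflection x y hxy hb
      exact ⟨C, hC, hCx, by simp⟩
  | insert a s ha ih =>
    obtain ⟨C, hC, hCx, hCs⟩ := ih
    by_cases hw : C *ᵥ P a = Q a
    · exact ⟨C, hC, hCx, by simpa [hw] using hCs⟩
    have hw0 : C *ᵥ P a - Q a ≠ 0 := sub_ne_zero.2 hw
    have hself : herm n (C *ᵥ P a) (C *ᵥ P a) = herm n (Q a) (Q a) := by rw [hC, hPQ]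
    have hyC : herm n y (C *ᵥ P a) = herm n y (Q a) := by
      rw [← hCx, hC, hCx, ← star_herm, hPx, star_herm]
    have hpos := re_herm_self_pos y (C *ᵥ P a - Q a) (hxy ▸ hx)
      (by rw [← star_herm, herm_sub_right, hyC, sub_self, star_zero]) hw0
    have hb : herm n (C *ᵥ P a) (C *ᵥ P a - Q a) ≠ 0 := by
      intro h
      have h' : herm n (C *ᵥ P a - Q a) (C *ᵥ P a) = 0 := by rw [← star_herm, h, star_zero]
      have : herm n (C *ᵥ P a - Q a) (C *ᵥ P a - Q a) = 0 := by
        rw [herm_sub_left, h]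
        rw [herm_sub_left, hself] at h'
        rw [herm_sub_right, zero_sub, neg_sub, h']
      rw [this] at hpos
      simp at hpos
    obtain ⟨R, hR, hRx, hRfix⟩ := exists_quasireflection _ _ hself hb
    refine ⟨R * C, hR.mul hC, ?_, ?_⟩
    · rw [← mulVec_mulVec, hCx, hRfix y hyC]
    · intro k hk
      rw [← mulVec_mulVec]
      rcases Finset.mem_insert.1 hk with rfl | hk
      · exact hRx
      · rw [hCs k hk]
        apply hRfix
        rw [← hCs k hk, hC, hCs k hk, hPQ]

end HermitianForm

lemma coe_re_add_norm_im_smul_rotInv (g : ℍq) : (g.re : ℍq) + ‖g.im‖ • rotInv g = g := by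
  unfold rotInv
  split_ifs with h
  · rw [smul_zero]
    conv_rhs => rw [← Quaternion.re_add_im g, h]
  · rw [smul_smul, mul_inv_cancel₀ (norm_ne_zero_iff.2 h), one_smul, Quaternion.re_add_im]

lemma norm_im_sq (g : ℍq) : ‖g.im‖ ^ 2 = ‖g‖ ^ 2 - g.re ^ 2 := by
  simp only [pow_two, ← Quaternion.normSq_eq_norm_mul_self, Quaternion.normSq_def']
  simp
  ring

/-- Equality of real part, norm and rotation invariant up to conjugation forces conjugacy. -/
lemma eq_conj_of_rotInv {g h μ : ℍq} (hμ : star μ * μ = 1) (hn : ‖g‖ = ‖h‖)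
    (hre : g.re = h.re) (hrot : rotInv g = star μ * rotInv h * μ) :
    g = star μ * h * μ := by
  have him : ‖g.im‖ = ‖h.im‖ := by
    rw [← sq_eq_sq₀ (norm_nonneg _) (norm_nonneg _), norm_im_sq, norm_im_sq, hn, hre]
  rw [← coe_re_add_norm_im_smul_rotInv g, hre, him, hrot]
  conv_rhs => rw [← coe_re_add_norm_im_smul_rotInv h]
  rw [mul_add, add_mul, ← Quaternion.coe_commutes, mul_assoc (h.re : ℍq), hμ, mul_one,
    mul_smul_comm, smul_mul_assoc]

lemma conj_mul_conj {a b μ : ℍq} (hμ' : μ * star μ = 1) :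
    star μ * a * μ * (star μ * b * μ) = star μ * (a * b) * μ := by
  rw [show star μ * a * μ * (star μ * b * μ) = star μ * a * (μ * star μ) * b * μ by
    noncomm_ring, hμ']
  noncomm_ring

lemma eq_conj_of_inv_mul_eq {a b a' b' μ : ℍq} (hμ' : μ * star μ = 1) (ha : a ≠ 0)
    (ha' : a' ≠ 0) (haa : a = star μ * a' * μ) (h : a⁻¹ * b = star μ * (a'⁻¹ * b') * μ) :
    b = star μ * b' * μ := by
  calc b = a * (a⁻¹ * b) := (mul_inv_cancel_left₀ ha b).symm
    _ = star μ * b' * μ := by rw [h, haa, conj_mul_conj hμ', mul_inv_cancel_left₀ ha']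

/-- **Boundary case (`i = m`, all points null).** Two semi-normalized `m`-tuples of null
vectors (`m ≥ 4`) with equal angular invariant `𝔸(p₁,p₂,p₃)`, and whose rotation
invariant `u(g_{23})` and the `m(m−3)/2` cross ratios agree up to conjugation by one
unit quaternion `μ`, are PSp(n,1)-congruent. -/
theorem moduli_congruence_boundary (n m : ℕ) (hm : 4 ≤ m)
    (p q : Fin m → Fin (n+1) → ℍq)
    (hp : SemiNormalized n m m p) (hq : SemiNormalized n m m q)
    (hA23 : angInv n (p ⟨0, by omega⟩) (p ⟨1, by omega⟩) (p ⟨2, by omega⟩)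
          = angInv n (q ⟨0, by omega⟩) (q ⟨1, by omega⟩) (q ⟨2, by omega⟩))
    (hμ : ∃ μ : ℍq, ‖μ‖ = 1 ∧
      (rotInv (herm n (p ⟨2, by omega⟩) (p ⟨1, by omega⟩))
        = star μ * rotInv (herm n (q ⟨2, by omega⟩) (q ⟨1, by omega⟩)) * μ) ∧
      (∀ j : Fin m, 3 ≤ (j : ℕ) →
        crossRatio n (p ⟨0, by omega⟩) (p ⟨1, by omega⟩) (p ⟨2, by omega⟩) (p j)
          = star μ * crossRatio n (q ⟨0, by omega⟩) (q ⟨1, by omega⟩) (q ⟨2, by omega⟩) (q j) * μ ∧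
        crossRatio n (p ⟨0, by omega⟩) (p ⟨2, by omega⟩) (p ⟨1, by omega⟩) (p j)
          = star μ * crossRatio n (q ⟨0, by omega⟩) (q ⟨2, by omega⟩) (q ⟨1, by omega⟩) (q j) * μ) ∧
      (∀ k j : Fin m, 3 ≤ (k : ℕ) → (k : ℕ) < (j : ℕ) →
        crossRatio n (p ⟨0, by omega⟩) (p k) (p ⟨1, by omega⟩) (p j)
          = star μ * crossRatio n (q ⟨0, by omega⟩) (q k) (q ⟨1, by omega⟩) (q j) * μ)) :
    PSpCongruent n m p q := by
  obtain ⟨μ, hμ1, hrot, hX, hY⟩ := hμ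
  obtain ⟨hp0, hpd, hpn, hp23, hp1, -, -⟩ := hp
  obtain ⟨hq0, hqd, hqn, hq23, hq1, -, -⟩ := hq
  have hns : normSq μ = 1 := by rw [Quaternion.normSq_eq_norm_mul_self, hμ1, one_mul]
  have hμl : star μ * μ = 1 := by rw [Quaternion.star_mul_self, hns, Quaternion.coe_one]
  have hμr : μ * star μ = 1 := by rw [Quaternion.self_mul_star, hns, Quaternion.coe_one]
  have hμ0 : μ ≠ 0 := by
    rintro rfl
    simp at hμ1
  set i0 : Fin m := ⟨0, by omega⟩ with hi0
  set i1 : Fin m := ⟨1, by omega⟩ with hi1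
  set i2 : Fin m := ⟨2, by omega⟩ with hi2
  have hpz : ∀ k, k ≠ i0 → herm n (p k) (p i0) = 1 := fun k hk =>
    hp1 i0 k rfl (Nat.one_le_iff_ne_zero.2 fun h => hk (Fin.ext h)) k.2
  have hqz : ∀ k, k ≠ i0 → herm n (q k) (q i0) = 1 := fun k hk =>
    hq1 i0 k rfl (Nat.one_le_iff_ne_zero.2 fun h => hk (Fin.ext h)) k.2
  have h10 : i1 ≠ i0 := by simp [hi0, hi1]
  have h20 : i2 ≠ i0 := by simp [hi0, hi2]
  have hpne : ∀ k l, k ≠ l → herm n (p k) (p l) ≠ 0 := fun k l hkl =>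
    herm_ne_zero_of_null _ _ (hp0 k) (hpn k k.2) (hpn l l.2) (hpd l k hkl.symm)
  have hqne : ∀ k l, k ≠ l → herm n (q k) (q l) ≠ 0 := fun k l hkl =>
    herm_ne_zero_of_null _ _ (hq0 k) (hqn k k.2) (hqn l l.2) (hqd l k hkl.symm)
  have hcross : ∀ a b c : Fin m, b ≠ i0 → c ≠ i0 → b ≠ a →
      crossRatio n (p i0) (p a) (p b) (p c)
        = star μ * crossRatio n (q i0) (q a) (q b) (q c) * μ →
      herm n (p b) (p a) = star μ * herm n (q b) (q a) * μ →
      herm n (p c) (p a) = star μ * herm n (q c) (q a) * μ := by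
    intro a b c hb hc hba hX hG
    simp only [crossRatio, hpz b hb, hpz c hc, hqz b hb, hqz c hc, one_mul, inv_one,
      mul_one] at hX
    exact eq_conj_of_inv_mul_eq hμr (hpne b a hba) (hqne b a hba) hG hX
  have hsymm : ∀ a b : Fin m, herm n (p a) (p b) = star μ * herm n (q a) (q b) * μ →
      herm n (p b) (p a) = star μ * herm n (q b) (q a) * μ := by
    intro a b h
    rw [← star_herm (p a), h, star_mul, star_mul, star_star, star_herm, mul_assoc]
  have hg23 : herm n (p i2) (p i1) = star μ * herm n (q i2) (q i1) * μ := by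
    have hnp := hp23 i1 i2 rfl rfl
    have hnq := hq23 i1 i2 rfl rfl
    refine eq_conj_of_rotInv hμl (hnp.trans hnq.symm) ?_ hrot
    have habs : ∀ g : ℍq, ‖g‖ = 1 → -1 ≤ -g.re ∧ -g.re ≤ 1 := by
      intro g hg
      have h1 := norm_im_sq g
      rw [hg] at h1
      have h2 := sq_nonneg ‖g.im‖
      exact ⟨by nlinarith, by nlinarith⟩
    have hang : ∀ z : Fin m → Fin (n+1) → ℍq, (∀ k, k ≠ i0 → herm n (z k) (z i0) = 1) →
        ‖herm n (z i2) (z i1)‖ = 1 →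
        angInv n (z i0) (z i1) (z i2) = Real.arccos (-(herm n (z i2) (z i1)).re) := by
      intro z hz hn
      rw [angInv, hz i2 h20, ← star_herm (z i1) (z i0), hz i1 h10, star_one, one_mul, mul_one,
        ← star_herm (z i2) (z i1), norm_star, hn, div_one]
      simp
    rw [hang p hpz hnp, hang q hqz hnq] at hA23
    have := Real.arccos_injOn (habs _ hnp) (habs _ hnq) hA23
    linarith
  have hlt : ∀ b a : Fin m, (b : ℕ) < (a : ℕ) →
      herm n (p a) (p b) = star μ * herm n (q a) (q b) * μ := by
    have hone : ∀ a : Fin m, i1 < a → herm n (p a) (p i1) = star μ * herm n (q a) (q i1) * μ := by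
      intro a ha
      by_cases h2 : a = i2
      · rw [h2, hg23]
      have ha3 : 3 ≤ (a : ℕ) := by grind
      exact hcross i1 i2 a h20 (by grind) (by grind) (hX a ha3).1 hg23
    intro b a hba
    have ha0 : a ≠ i0 := by grind
    by_cases hb0 : b = i0
    · rw [hb0, hpz a ha0, hqz a ha0, mul_one, hμl]
    by_cases hb1 : b = i1
    · subst hb1
      exact hone a hba
    by_cases hb2 : b = i2
    · subst hb2
      exact hcross i2 i1 a h10 ha0 (by grind) (hX a hba).2 (hsymm _ _ hg23)
    · have hb3 : 3 ≤ (b : ℕ) := by grind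
      exact hcross b i1 a h10 ha0 (Ne.symm hb1) (hY b a hb3 hba) (hsymm _ _ (hone b (by grind)))
  have hgram : ∀ a b : Fin m, herm n (p a) (p b) = star μ * herm n (q a) (q b) * μ := by
    intro a b
    rcases lt_trichotomy (b : ℕ) (a : ℕ) with h | h | h
    · exact hlt b a h
    · obtain rfl := Fin.ext h
      rw [hpn b b.2, hqn b b.2, mul_zero, zero_mul]
    · exact hsymm _ _ (hlt a b h)
  have hgram' : ∀ a b : Fin m, herm n (p a) (p b)
      = herm n (fun j => q a j * μ) (fun j => q b j * μ) := by
    intro a b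
    rw [herm_mul_left, herm_mul_right, hgram]
  obtain ⟨C, hC, -, hCp⟩ := exists_isometry_of_gram_eq Finset.univ (p i0 - p i1)
    ((fun j => q i0 j * μ) - fun j => q i1 j * μ) p (fun k j => q k j * μ)
    (by
      rw [herm_sub_left, herm_sub_right, herm_sub_right, hpn i0 i0.2, hpn i1 i1.2, hpz i1 h10,
        ← star_herm (p i1) (p i0), hpz i1 h10]
      simp)
    (by simp only [herm_sub_left, herm_sub_right, hgram'])
    (fun k => by simp only [herm_sub_right, hgram'])
    hgram'
  exact ⟨C, hC.conjTranspose_mul_mul, fun _ => μ, fun _ => hμ0, fun k => hCp k (Finset.mem_univ k)⟩
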